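/- Let (X,d) be a compact metric space, f : X → X a continuous map, x ∈ X, and C a chain component of f with ω(x,f) ⊆ C. If ω(x,f) ∩ Sen(f|_{CR(f)}) ≠ ∅, then f|_C : C → C is not chain continuous. -/

import Mathlib

open Filter Topology Set

section Defs

variable {X : Type*} [MetricSpace X]

/-- `c 0, c 1, ..., c k` is a `δ`-chain of `f`. -/
def IsDeltaChain (f : X → X) (δ : ℝ) (c : ℕ → X) (k : ℕ) : Prop :=
  ∀ i < k, dist (f (c i)) (c (i + 1)) ≤ δ

/-- `x → y` : for every `δ > 0` there is a `δ`-chain of `f` from `x` to `y`. -/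
def ChainReach (f : X → X) (x y : X) : Prop :=
  ∀ δ > 0, ∃ (c : ℕ → X) (k : ℕ), 1 ≤ k ∧ IsDeltaChain f δ c k ∧ c 0 = x ∧ c k = y

/-- `C(x) = {x} ∪ {y : x → y}`. -/
def CSet (f : X → X) (x : X) : Set X := {x} ∪ {y | ChainReach f x y}

/-- The chain recurrent set. -/
def CR (f : X → X) : Set X := {x | ChainReach f x x}

/-- `C` is a chain component of `f` : an equivalence class of `↔` on `CR f`. -/
def IsChainComponent (f : X → X) (C : Set X) : Prop :=
  ∃ x ∈ CR f, C = {y ∈ CR f | ChainReach f x y ∧ ChainReach f y x}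

/-- A set `S` is chain stable for `f`. -/
def ChainStable (f : X → X) (S : Set X) : Prop :=
  ∀ ε > 0, ∃ δ > 0, ∀ (c : ℕ → X) (k : ℕ), 1 ≤ k → IsDeltaChain f δ c k → c 0 ∈ S →
    ∀ i ≤ k, Metric.infDist (c i) S ≤ ε

/-- `ξ` is a `δ`-pseudo orbit of `f`. -/
def IsPseudoOrbit (f : X → X) (δ : ℝ) (ξ : ℕ → X) : Prop :=
  ∀ i, dist (f (ξ i)) (ξ (i + 1)) ≤ δ

/-- `x` is a shadowable point of `f`. -/
def ShadowablePt (f : X → X) (x : X) : Prop :=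
  ∀ ε > 0, ∃ δ > 0, ∀ ξ : ℕ → X, IsPseudoOrbit f δ ξ → ξ 0 = x →
    ∃ y, ∀ i, dist (f^[i] y) (ξ i) ≤ ε

/-- `f` has the shadowing on `S`. -/
def ShadowingOn (f : X → X) (S : Set X) : Prop :=
  ∀ ε > 0, ∃ δ > 0, ∀ ξ : ℕ → X, IsPseudoOrbit f δ ξ → (∀ i, ξ i ∈ S) →
    ∃ y, ∀ i, dist (f^[i] y) (ξ i) ≤ ε

/-- `f` has the shadowing property. -/
def ShadowingProperty (f : X → X) : Prop :=
  ∀ ε > 0, ∃ δ > 0, ∀ ξ : ℕ → X, IsPseudoOrbit f δ ξ →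
    ∃ y, ∀ i, dist (f^[i] y) (ξ i) ≤ ε

/-- `f` is chain transitive. -/
def ChainTransitive (f : X → X) : Prop := ∀ x y : X, ChainReach f x y

/-- `f` restricted to `S` is chain continuous. -/
def ChainContinuousOn (f : X → X) (S : Set X) : Prop :=
  ∀ ε > 0, ∃ δ > 0, ∀ ξ η : ℕ → X, IsPseudoOrbit f δ ξ → IsPseudoOrbit f δ η →
    (∀ i, ξ i ∈ S) → (∀ i, η i ∈ S) → ξ 0 = η 0 → ∀ i, dist (ξ i) (η i) ≤ ε

/-- `f` restricted to `S` is equicontinuous. -/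
def EquicontinuousOnSet (f : X → X) (S : Set X) : Prop :=
  ∀ ε > 0, ∃ δ > 0, ∀ x ∈ S, ∀ y ∈ S, dist x y ≤ δ → ∀ i : ℕ, dist (f^[i] x) (f^[i] y) ≤ ε

/-- `s_n(f,K,r)` : largest cardinality of an `(n,r)`-separated subset of `K`. -/
noncomputable def sepNum (f : X → X) (K : Set X) (n : ℕ) (r : ℝ) : ℕ :=
  sSup {m | ∃ E : Finset X, (E : Set X) ⊆ K ∧
    (∀ x ∈ E, ∀ y ∈ E, x ≠ y → ∃ i < n, r < dist (f^[i] x) (f^[i] y)) ∧ E.card = m}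

/-- `h(f,K,r) = limsup (1/n) log s_n(f,K,r)`. -/
noncomputable def entH (f : X → X) (K : Set X) (r : ℝ) : EReal :=
  Filter.limsup (fun n : ℕ => ((Real.log (sepNum f K n r) / n : ℝ) : EReal)) Filter.atTop

/-- `h(f,K) = lim_{r → 0} h(f,K,r) = sup_{r > 0} h(f,K,r)`. -/
noncomputable def ent (f : X → X) (K : Set X) : EReal :=
  ⨆ r ∈ Set.Ioi (0 : ℝ), entH f K r

/-- `Ent_r(f)`. -/
def EntR (f : X → X) (r : ℝ) : Set X :=
  {x | ∀ K : Set X, IsClosed K → K ∈ 𝓝 x → 0 < entH f K r}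

/-- `Ent_{r,b}(f)`. -/
def EntRB (f : X → X) (r b : ℝ) : Set X :=
  {x | ∀ K : Set X, IsClosed K → K ∈ 𝓝 x → (b : EReal) ≤ entH f K r}

/-- The ω-limit set of `x` under `f`. -/
def omegaLim (f : X → X) (x : X) : Set X :=
  {y | ∃ φ : ℕ → ℕ, StrictMono φ ∧ Tendsto (fun j => f^[φ j] x) atTop (𝓝 y)}

/-- The set of `e`-sensitive points of `f` restricted to `S`. -/
def SenE (f : X → X) (S : Set X) (e : ℝ) : Set X :=
  {x ∈ S | ∀ ε > 0, ∃ y ∈ S, dist x y ≤ ε ∧ ∃ i : ℕ, e < dist (f^[i] x) (f^[i] y)}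

/-- `Sen(f|_S) = ⋃_{e > 0} Sen_e(f|_S)`. -/
def Sen (f : X → X) (S : Set X) : Set X := ⋃ e ∈ Set.Ioi (0 : ℝ), SenE f S e

/-- `(x,y)` is a scrambled pair for `f`. -/
def ScrambledPair (f : X → X) (x y : X) : Prop :=
  0 < Filter.limsup (fun i : ℕ => dist (f^[i] x) (f^[i] y)) Filter.atTop ∧
    Filter.liminf (fun i : ℕ => dist (f^[i] x) (f^[i] y)) Filter.atTop = 0

/-- `M` is a minimal set for `f`. -/
def IsMinimalSet (f : X → X) (M : Set X) : Prop :=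
  IsClosed M ∧ MapsTo f M M ∧ ∀ S ⊆ M, IsClosed S → MapsTo f S S → S = ∅ ∨ S = M

/-- `Φ_ε(x)`. -/
def Phi (f : X → X) (ε : ℝ) (x : X) : Set X :=
  {y | ∀ i : ℕ, dist (f^[i] x) (f^[i] y) ≤ ε}

/-- `h*_f(ε) = sup_x h(f,Φ_ε(x))`. -/
noncomputable def hStar (f : X → X) (ε : ℝ) : EReal := ⨆ x : X, ent f (Phi f ε x)

/-- `f` is h-expansive. -/
def HExpansive (f : X → X) : Prop := ∃ ε > 0, hStar f ε = 0

end Defs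

theorem isDeltaChain_transGen {X : Type*} [MetricSpace X] {f : X → X} {δ : ℝ} {c : ℕ → X}
    {k : ℕ} (hk : 1 ≤ k) (h : IsDeltaChain f δ c k) :
    Relation.TransGen (fun a b => dist (f a) b ≤ δ) (c 0) (c k) := by
  induction k, hk using Nat.le_induction with
  | base => exact .single (h 0 one_pos)
  | succ k hk ih => exact .tail (ih fun i hi => h i (hi.trans k.lt_succ_self)) (h k k.lt_succ_self)

theorem exists_isDeltaChain_of_transGen {X : Type*} [MetricSpace X] {f : X → X} {δ : ℝ} {x y : X}
    (h : Relation.TransGen (fun a b => dist (f a) b ≤ δ) x y) :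
    ∃ (c : ℕ → X) (k : ℕ), 1 ≤ k ∧ IsDeltaChain f δ c k ∧ c 0 = x ∧ c k = y := by
  induction h using Relation.TransGen.head_induction_on with
  | @single a h =>
    refine ⟨fun n => if n = 0 then a else y, 1, le_rfl, ?_, by simp, by simp⟩
    intro i hi
    obtain rfl : i = 0 := by omega
    simpa using h
  | @head a b hab _ ih =>
    obtain ⟨c, k, hk, hc, h0, hy⟩ := ih
    refine ⟨fun n => Nat.casesOn n a c, k + 1, by omega, ?_, rfl, hy⟩
    rintro (_ | i) hi
    · simpa [h0] using hab
    · exact hc i (by omega)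

/-- Chain reachability in terms of the transitive closure of the one-step relations. -/
theorem chainReach_iff_transGen {X : Type*} [MetricSpace X] {f : X → X} {x y : X} :
    ChainReach f x y ↔ ∀ δ > 0, Relation.TransGen (fun a b => dist (f a) b ≤ δ) x y := by
  refine forall₂_congr fun δ _ => ⟨?_, exists_isDeltaChain_of_transGen⟩
  rintro ⟨c, k, hk, hc, rfl, rfl⟩
  exact isDeltaChain_transGen hk hc

theorem ChainReach.trans {X : Type*} [MetricSpace X] {f : X → X} {x y z : X}
    (hxy : ChainReach f x y) (hyz : ChainReach f y z) : ChainReach f x z := by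
  rw [chainReach_iff_transGen] at *
  exact fun δ hδ => (hxy δ hδ).trans (hyz δ hδ)

theorem chainReach_map {X : Type*} [MetricSpace X] (f : X → X) (x : X) :
    ChainReach f x (f x) :=
  chainReach_iff_transGen.2 fun δ hδ => .single (by simpa using hδ.le)

theorem transGen_perturb_left {X : Type*} [MetricSpace X] {f : X → X} {δ ε : ℝ} {a a' b : X}
    (hε : 0 ≤ ε) (h : Relation.TransGen (fun a b => dist (f a) b ≤ δ) a b)
    (ha : dist (f a') (f a) ≤ ε) :
    Relation.TransGen (fun a b => dist (f a) b ≤ ε + δ) a' b := by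
  obtain ⟨c, hac, hcb⟩ := Relation.TransGen.head'_iff.1 h
  refine Relation.TransGen.head'_iff.2 ⟨c, (dist_triangle _ (f a) _).trans (add_le_add ha hac), ?_⟩
  exact Relation.ReflTransGen.mono (fun u v (huv : dist (f u) v ≤ δ) => by linarith) _ _ hcb

theorem transGen_perturb_right {X : Type*} [MetricSpace X] {f : X → X} {δ ε : ℝ} {a b b' : X}
    (hε : 0 ≤ ε) (h : Relation.TransGen (fun a b => dist (f a) b ≤ δ) a b)
    (hb : dist b b' ≤ ε) :
    Relation.TransGen (fun a b => dist (f a) b ≤ δ + ε) a b' := by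
  obtain ⟨c, hac, hcb⟩ := Relation.TransGen.tail'_iff.1 h
  refine Relation.TransGen.tail'_iff.2 ⟨c, ?_, (dist_triangle _ b _).trans (add_le_add hcb hb)⟩
  exact Relation.ReflTransGen.mono (fun u v (huv : dist (f u) v ≤ δ) => by linarith) _ _ hac

/-- The relation `→` is closed, in sequential form. -/
theorem chainReach_of_tendsto {X : Type*} [MetricSpace X] {f : X → X} (hf : Continuous f)
    {u v : ℕ → X} {a b : X} (hu : Tendsto u atTop (𝓝 a)) (hv : Tendsto v atTop (𝓝 b))
    (h : ∀ᶠ n in atTop, ChainReach f (u n) (v n)) : ChainReach f a b := by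
  rw [chainReach_iff_transGen]
  intro δ hδ
  have hfu := (hf.tendsto a).comp hu
  have hδ3 : 0 < δ / 3 := by positivity
  obtain ⟨n, hn, hna, hnb⟩ := (h.and ((Metric.tendsto_nhds.1 hfu _ hδ3).and
    (Metric.tendsto_nhds.1 hv _ hδ3))).exists
  have := transGen_perturb_right hδ3.le (transGen_perturb_left (a' := a) hδ3.le
    (chainReach_iff_transGen.1 hn _ hδ3) (by rw [dist_comm]; exact hna.le)) hnb.le
  convert this using 4
  ring

theorem ChainReach.map_left {X : Type*} [MetricSpace X] {f : X → X} (hf : Continuous f)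
    {a b : X} (hab : ChainReach f a b) (hb : ChainReach f b b) : ChainReach f (f a) b := by
  rw [chainReach_iff_transGen] at *
  intro δ hδ
  obtain ⟨η, hη, hfη⟩ := Metric.continuous_iff.1 hf (f a) (δ / 2) (by positivity)
  set γ := min (η / 2) (δ / 2)
  have hγ : 0 < γ := by positivity
  obtain ⟨c, hac, hcb⟩ := Relation.TransGen.head'_iff.1 (hab γ hγ)
  have hc : dist (f (f a)) (f c) ≤ δ / 2 := by
    rw [dist_comm]
    refine (hfη c ?_).le
    rw [dist_comm]
    linarith [min_le_left (η / 2) (δ / 2)]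
  refine Relation.TransGen.mono (fun u v (huv : dist (f u) v ≤ _) => ?_) _ _
    (transGen_perturb_left (by positivity) (Relation.TransGen.trans_right hcb (hb γ hγ)) hc)
  linarith [min_le_right (η / 2) (δ / 2)]

theorem chainReach_iterate_left {X : Type*} [MetricSpace X] {f : X → X} (hf : Continuous f)
    {y : X} (hy : y ∈ CR f) (i : ℕ) : ChainReach f (f^[i] y) y := by
  induction i with
  | zero => exact hy
  | succ i ih =>
    rw [Function.iterate_succ_apply']
    exact ih.map_left hf hy

theorem chainReach_iterate_right {X : Type*} [MetricSpace X] {f : X → X}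
    {y : X} (hy : y ∈ CR f) (i : ℕ) : ChainReach f y (f^[i] y) := by
  induction i with
  | zero => exact hy
  | succ i ih =>
    rw [Function.iterate_succ_apply']
    exact ih.trans (chainReach_map f _)

theorem IsChainComponent.mem_of_chainReach {X : Type*} [MetricSpace X] {f : X → X} {C : Set X}
    (hC : IsChainComponent f C) {p z : X} (hp : p ∈ C) (hpz : ChainReach f p z)
    (hzp : ChainReach f z p) : z ∈ C := by
  obtain ⟨x, -, rfl⟩ := hC
  exact ⟨hzp.trans hpz, hp.2.1.trans hpz, hzp.trans hp.2.2⟩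

/-- Forward orbits of chain recurrent points close to a chain component stay close to it. -/
theorem IsChainComponent.exists_orbit_close {X : Type*} [MetricSpace X] [CompactSpace X]
    {f : X → X} (hf : Continuous f) {C : Set X} (hC : IsChainComponent f C) {p : X} (hp : p ∈ C)
    {η : ℝ} (hη : 0 < η) :
    ∃ r > 0, ∀ y ∈ CR f, dist p y ≤ r → ∀ i : ℕ, ∃ z ∈ C, dist (f^[i] y) z ≤ η := by
  by_contra! H
  choose y hyCR hy i hi using fun n : ℕ => H (1 / ((n : ℝ) + 1)) (by positivity)
  have hyp : Tendsto y atTop (𝓝 p) := by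
    rw [tendsto_iff_dist_tendsto_zero]
    refine squeeze_zero (fun _ => dist_nonneg) (fun n => ?_)
      tendsto_one_div_add_atTop_nhds_zero_nat
    rw [dist_comm]
    exact hy n
  obtain ⟨z, φ, hφ, hz⟩ := CompactSpace.tendsto_subseq fun n => f^[i n] (y n)
  have hyφ := hyp.comp hφ.tendsto_atTop
  have hzC : z ∈ C := hC.mem_of_chainReach hp
    (chainReach_of_tendsto hf hyφ hz (.of_forall fun n => chainReach_iterate_right (hyCR _) _))
    (chainReach_of_tendsto hf hz hyφ (.of_forall fun n => chainReach_iterate_left hf (hyCR _) _))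
  obtain ⟨n, hn⟩ := (Metric.tendsto_nhds.1 hz η hη).exists
  exact (hi (φ n) z hzC).not_gt hn

/-- A chain continuous chain component contains no sensitive point of `f` restricted to `CR f`. -/
theorem ChainContinuousOn.disjoint_sen {X : Type*} [MetricSpace X] [CompactSpace X] {f : X → X}
    (hf : Continuous f) {C : Set X} (hC : IsChainComponent f C) (hcc : ChainContinuousOn f C) :
    Disjoint C (Sen f (CR f)) := by
  rw [Set.disjoint_left]
  intro p hp hsen
  simp only [Sen, Set.mem_iUnion, Set.mem_Ioi, exists_prop] at hsen
  obtain ⟨e, he, hpCR, hsen⟩ := hsen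
  obtain ⟨δ, hδ, hcc⟩ := hcc (e / 2) (by positivity)
  obtain ⟨γ, hγ, hfγ⟩ := Metric.uniformContinuous_iff.1
    (CompactSpace.uniformContinuous_of_continuous hf) (δ / 2) (by positivity)
  set η := min (γ / 2) (min (δ / 2) (e / 2))
  have hη : 0 < η := by positivity
  have hηγ : η < γ := (min_le_left _ _).trans_lt (by linarith)
  have hηδ : η ≤ δ / 2 := (min_le_right _ _).trans (min_le_left _ _)
  have hηe : η ≤ e / 2 := (min_le_right _ _).trans (min_le_right _ _)
  obtain ⟨r, hr, H⟩ := hC.exists_orbit_close hf hp hη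
  obtain ⟨y, hyCR, hpy, i, hi⟩ := hsen (min r η) (lt_min hr hη)
  choose z hzC hz using H y hyCR (hpy.trans (min_le_left _ _))
  set ξ : ℕ → X := fun n => if n = 0 then p else z n with hξdef
  have hξC : ∀ n, ξ n ∈ C := fun n => by
    simp only [hξdef]
    split_ifs
    exacts [hp, hzC n]
  have hξ : ∀ n, dist (f^[n] y) (ξ n) ≤ η := fun n => by
    by_cases hn : n = 0
    · subst hn
      simpa [hξdef, dist_comm] using hpy.trans (min_le_right _ _)
    · simpa [hξdef, hn] using hz n
  have horb : ∀ n, f^[n] p ∈ C := fun n => hC.mem_of_chainReach hp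
    (chainReach_iterate_right hpCR n) (chainReach_iterate_left hf hpCR n)
  have hclose := hcc (fun n => f^[n] p) ξ
    (fun n => by simpa [← Function.iterate_succ_apply'] using hδ.le)
    (fun n => by
      have h1 := hfγ ((dist_comm _ _).trans_le (hξ n) |>.trans_lt hηγ)
      have h2 := hξ (n + 1)
      rw [Function.iterate_succ_apply'] at h2
      linarith [dist_triangle (f (ξ n)) (f (f^[n] y)) (ξ (n + 1))])
    horb hξC (by simp [hξdef]) i
  linarith [dist_triangle_right (f^[i] p) (f^[i] y) (ξ i), hξ i]

/-- Theorem 1.3 (1): if `ω(x,f) ∩ Sen(f|_{CR(f)}) ≠ ∅`, then `f|_C` is not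
chain continuous. -/
theorem stmt_4 {X : Type*} [MetricSpace X] [CompactSpace X] (f : X → X)
    (hf : Continuous f) (x : X) (C : Set X) (hC : IsChainComponent f C)
    (hω : omegaLim f x ⊆ C) (hsen : (omegaLim f x ∩ Sen f (CR f)).Nonempty) :
    ¬ ChainContinuousOn f C := by
  intro hcc
  obtain ⟨p, hpω, hps⟩ := hsen
  exact Set.disjoint_left.1 (hcc.disjoint_sen hf hC) (hω hpω) hps
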